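/- Fix a finite set 𝗄 ⊂ ℕ, r ≥ 0, and a basic moduli specification 𝔟 = (𝗄, 𝗅, β). For ρ ∈ R_𝗄^r and a (𝔟, r)-labeled tree 𝒯 with underlying marked tree 𝒯̲ ∈ T_𝗄^r, define ρ.𝒯 as follows: keep the data 𝗅_𝒯(v_i) and β_𝒯(v_i) at each vertex v_i, replace the boundary data by 𝗄_{ρ.𝒯}(v_i) = F^ρ_{𝒯̲}(𝗄_𝒯(v_i)) = 𝗄_{α^ρ(𝒯̲)}(v_i) and σ_{ρ.𝒯}(v_i) = σ_{α^ρ(𝒯̲)}(v_i), and then relabel the vertices by the unique permutation restoring condition (c). Then ρ.𝒯 is again a (𝔟, r)-labeled tree, and this assignment defines a group action of R_𝗄^r on the set of (𝔟, r)-labeled trees; in particular (ρ₁ρ₂).𝒯 = ρ₁.(ρ₂.𝒯) for all ρ₁, ρ₂ ∈ R_𝗄^r. (This is the combinatorial content of the lemma that the finite group R_𝗄^r acts on the resolution 𝓜̌_𝔟^r.) -/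

import Mathlib

/-!
Basic combinatorial set-up for `(𝔟, r)`-labeled trees.

We fix a basic moduli specification `𝔟 = (𝗄, 𝗅, β)` with `𝗄 ⊂ ℕ`, encoded by a pair of
finite sets `kk ll : Finset ℕ` and a natural number `β`.  For `r ≥ 0`, a `(𝔟, r)`-labeled
tree has vertices `v_1, …, v_{r+1}` (encoded by `Fin (r+1)`) and oriented labeled edges
`e_1, …, e_r` (encoded by `Fin r`).  The boundary markings attached to a vertex form a
finite subset of `𝗄 ⊔ {★″_1, …, ★″_r}`, encoded as `Finset (ℕ ⊕ Fin r)` with `Sum.inr j`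
playing the role of `★″_j`; the superfluous markings `★′_j` attached to a vertex are
encoded by their index set, a `Finset (Fin r)`.
-/

/-- The simple graph on the vertex set `V` generated by the oriented edges in `E`;
edge `e` joins `tail e` to `head e`. -/
def treeGraph {r : ℕ} {V : Type*} (tail head : Fin r → V) (E : Finset (Fin r)) :
    SimpleGraph V :=
  SimpleGraph.fromRel (fun x y => ∃ e ∈ E, tail e = x ∧ head e = y)

/-- A `(𝔟, r)`-labeled tree for the basic moduli specification `𝔟 = (kk, ll, β)`.
Each vertex `i` carries a sturdy moduli specification
`((kv i, lv i, bv i), sv i)`; the vertex `i` is the head (resp. tail) of the edge `e`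
iff `★″_e ∈ kv i` (resp. `★′_e ∈ sv i`); the `kv i` partition `kk ⊔ {★″_1, …, ★″_r}`,
the `lv i` partition `ll`, the `sv i` partition `{★′_1, …, ★′_r}` and `∑ bv i = β`;
the resulting graph is a tree (it has `r` edges on `r + 1` vertices, so this is
connectivity); and the vertex labels satisfy condition (c). -/
structure LabeledTree (kk ll : Finset ℕ) (β r : ℕ) where
  kv : Fin (r + 1) → Finset (ℕ ⊕ Fin r)
  lv : Fin (r + 1) → Finset ℕ
  bv : Fin (r + 1) → ℕ
  sv : Fin (r + 1) → Finset (Fin r)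
  head : Fin r → Fin (r + 1)
  tail : Fin r → Fin (r + 1)
  mem_head : ∀ (e : Fin r) (i : Fin (r + 1)), Sum.inr e ∈ kv i ↔ head e = i
  mem_tail : ∀ (e : Fin r) (i : Fin (r + 1)), e ∈ sv i ↔ tail e = i
  sturdy : ∀ i, 3 ≤ (kv i).card + 2 * (lv i).card + 3 * bv i
  orient : ∀ i, Odd ((kv i).card + bv i)
  kv_disjoint : ∀ i j, i ≠ j → Disjoint (kv i) (kv j)
  kv_union : Finset.univ.biUnion kv
      = kk.image Sum.inl ∪ (Finset.univ : Finset (Fin r)).image Sum.inr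
  lv_disjoint : ∀ i j, i ≠ j → Disjoint (lv i) (lv j)
  lv_union : Finset.univ.biUnion lv = ll
  sv_disjoint : ∀ i j, i ≠ j → Disjoint (sv i) (sv j)
  sv_union : Finset.univ.biUnion sv = (Finset.univ : Finset (Fin r))
  bv_sum : ∑ i, bv i = β
  connected : (treeGraph tail head Finset.univ).Connected
  cond_c : ∀ (a : Fin r) (x y : Fin (r + 1)),
    (treeGraph tail head (Finset.univ.filter (fun e => e < a))).Reachable (tail a) x →
    (treeGraph tail head (Finset.univ.filter (fun e => e < a))).Reachable (head a) y →
    x < y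

/-- A labeled tree is *odd-even* if every vertex of even degree carries no superfluous
markings `★′`, and every vertex of odd degree carries no boundary markings. -/
def IsOddEven {kk ll : Finset ℕ} {β r : ℕ} (T : LabeledTree kk ll β r) : Prop :=
  ∀ i, (Even (T.bv i) → T.sv i = ∅) ∧ (Odd (T.bv i) → T.kv i = ∅)

/-- A labeled tree is *sorted* if the graph spanned by the edges `e_1, …, e_a` is
connected for every `1 ≤ a ≤ r`, and the set of `★′`-indices at each vertex is an
interval. -/
def IsSorted {kk ll : Finset ℕ} {β r : ℕ} (T : LabeledTree kk ll β r) : Prop :=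
  (∀ a : Fin r, ∀ x y : Fin (r + 1),
      (∃ e : Fin r, e ≤ a ∧ (T.tail e = x ∨ T.head e = x)) →
      (∃ e : Fin r, e ≤ a ∧ (T.tail e = y ∨ T.head e = y)) →
      (treeGraph T.tail T.head (Finset.univ.filter (fun e => e ≤ a))).Reachable x y) ∧
  (∀ v : Fin (r + 1), ∀ i a j : Fin r,
      i ∈ T.sv v → j ∈ T.sv v → i ≤ a → a ≤ j → a ∈ T.sv v)

/-!
Statement 3: the group `R_𝗄^r` acts on the set of `(𝔟, r)`-labeled trees.

`T_𝗄^r` is the set of trees on vertices `v_1, …, v_{r+1}` with oriented labeled edges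
`e_1, …, e_r` and inward half-edges labeled by `𝗄`; such a tree is given by the pair of
partitions `(kv, sv)` as for labeled trees (forgetting the interior data `lv, bv` and
the vertex-ordering condition (c)).  `R̂_𝗄^r` is the subgroup of
`Sym(T_𝗄^r × (𝗄 ⊔ {★″_1, …, ★″_r}))` of permutations `ρ` admitting a witness
`(α^ρ, (F^ρ_𝒯)_𝒯)` with `ρ(𝒯, x) = (α^ρ 𝒯, F^ρ_𝒯 x)` and
`F^ρ_𝒯(𝗄_𝒯(v_i)) = 𝗄_{α^ρ 𝒯}(v_i)`, and `R_𝗄^r ≤ R̂_𝗄^r` consists of the elements fixed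
under conjugation by the vertex-relabeling action of `Sym({v_1, …, v_{r+1}})`.

For `ρ ∈ R_𝗄^r` and a labeled tree `𝒯`, the tree `ρ.𝒯` keeps the interior data
`𝗅_𝒯(v_i), β_𝒯(v_i)`, replaces the marked-tree data by that of `α^ρ(𝒯̲)`, and relabels
the vertices by the unique permutation restoring condition (c).  The theorem asserts
that there is a map `act` on labeled trees, characterized this way (via a vertex
relabeling `w`), which is a group action of `R_𝗄^r`.
-/

/-- A marked tree in `T_𝗄^r`: the boundary data of a labeled tree, with no ordering
condition on the vertices. -/
structure MarkedTree (kk : Finset ℕ) (r : ℕ) where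
  kv : Fin (r + 1) → Finset (ℕ ⊕ Fin r)
  sv : Fin (r + 1) → Finset (Fin r)
  head : Fin r → Fin (r + 1)
  tail : Fin r → Fin (r + 1)
  mem_head : ∀ (e : Fin r) (i : Fin (r + 1)), Sum.inr e ∈ kv i ↔ head e = i
  mem_tail : ∀ (e : Fin r) (i : Fin (r + 1)), e ∈ sv i ↔ tail e = i
  kv_disjoint : ∀ i j, i ≠ j → Disjoint (kv i) (kv j)
  kv_union : Finset.univ.biUnion kv
      = kk.image Sum.inl ∪ (Finset.univ : Finset (Fin r)).image Sum.inr
  sv_disjoint : ∀ i j, i ≠ j → Disjoint (sv i) (sv j)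
  sv_union : Finset.univ.biUnion sv = (Finset.univ : Finset (Fin r))
  connected : (treeGraph tail head Finset.univ).Connected

/-- The marked tree `𝒯̲` underlying a labeled tree `𝒯`. -/
def LabeledTree.toMarked {kk ll : Finset ℕ} {β r : ℕ} (T : LabeledTree kk ll β r) :
    MarkedTree kk r :=
  ⟨T.kv, T.sv, T.head, T.tail, T.mem_head, T.mem_tail, T.kv_disjoint, T.kv_union,
    T.sv_disjoint, T.sv_union, T.connected⟩

/-- The set `𝗄 ⊔ {★″_1, …, ★″_r}` of boundary markings, as a subtype. -/
def BMark (kk : Finset ℕ) (r : ℕ) : Type :=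
  {x : ℕ ⊕ Fin r // x ∈ kk.image Sum.inl ∪ (Finset.univ : Finset (Fin r)).image Sum.inr}

/-- `(α, F)` is a witness exhibiting `ρ` as an element of `R̂_𝗄^r`. -/
def IsWitness (kk : Finset ℕ) (r : ℕ)
    (ρ : Equiv.Perm (MarkedTree kk r × BMark kk r))
    (α : Equiv.Perm (MarkedTree kk r))
    (F : MarkedTree kk r → Equiv.Perm (BMark kk r)) : Prop :=
  (∀ T x, ρ (T, x) = (α T, F T x)) ∧
  ∀ (T : MarkedTree kk r) (i : Fin (r + 1)) (x : BMark kk r),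
    x.val ∈ T.kv i ↔ (F T x).val ∈ (α T).kv i

/-- Membership in `R̂_𝗄^r`. -/
def MemRhat (kk : Finset ℕ) (r : ℕ)
    (ρ : Equiv.Perm (MarkedTree kk r × BMark kk r)) : Prop :=
  ∃ α F, IsWitness kk r ρ α F

/-- `T'` is obtained from `T` by relabeling the vertices by `w` (the data at the new
vertex `i` is the data of the old vertex `w⁻¹ i`; the heads and tails of the edges are
determined by the partitions). -/
def IsVertexRelabel (kk : Finset ℕ) (r : ℕ) (w : Equiv.Perm (Fin (r + 1)))
    (T T' : MarkedTree kk r) : Prop :=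
  (∀ i, T'.kv i = T.kv (w⁻¹ i)) ∧ (∀ i, T'.sv i = T.sv (w⁻¹ i))

/-- Membership in `R_𝗄^r`: an element of `R̂_𝗄^r` fixed under conjugation by the
vertex-relabeling action of `Sym({v_1, …, v_{r+1}})` on `T_𝗄^r × (𝗄 ⊔ ★″)`. -/
def MemR (kk : Finset ℕ) (r : ℕ)
    (ρ : Equiv.Perm (MarkedTree kk r × BMark kk r)) : Prop :=
  MemRhat kk r ρ ∧
  ∀ (w : Equiv.Perm (Fin (r + 1))) (T T' : MarkedTree kk r) (x : BMark kk r),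
    IsVertexRelabel kk r w T T' →
    IsVertexRelabel kk r w (ρ (T, x)).1 (ρ (T', x)).1 ∧ (ρ (T', x)).2 = (ρ (T, x)).2

/-- `T'` is the labeled tree with marked data `S` and the interior data of `T`, after
relabeling the vertices by some permutation `w` (unique, since `T'` satisfies
condition (c)). -/
def IsInducedBy {kk ll : Finset ℕ} {β r : ℕ}
    (T' : LabeledTree kk ll β r) (S : MarkedTree kk r) (T : LabeledTree kk ll β r) :
    Prop :=
  ∃ w : Equiv.Perm (Fin (r + 1)),
    (∀ i, T'.kv i = S.kv (w⁻¹ i)) ∧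
    (∀ i, T'.sv i = S.sv (w⁻¹ i)) ∧
    (∀ i, T'.lv i = T.lv (w⁻¹ i)) ∧
    (∀ i, T'.bv i = T.bv (w⁻¹ i))

section TreeGraph

variable {r : ℕ} {V : Type*} {tail head : Fin r → V}

theorem treeGraph_adj {E : Finset (Fin r)} {x y : V} :
    (treeGraph tail head E).Adj x y ↔
      x ≠ y ∧ ∃ e ∈ E, (tail e = x ∧ head e = y) ∨ (tail e = y ∧ head e = x) := by
  simp only [treeGraph, SimpleGraph.fromRel_adj]
  grind

theorem treeGraph_mono {E E' : Finset (Fin r)} (h : E ⊆ E') :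
    treeGraph tail head E ≤ treeGraph tail head E' := by
  intro x y hxy
  rw [treeGraph_adj] at hxy ⊢
  obtain ⟨hne, e, he, h'⟩ := hxy
  exact ⟨hne, e, h he, h'⟩

theorem treeGraph_reachable_edge {E : Finset (Fin r)} {e : Fin r} (he : e ∈ E) :
    (treeGraph tail head E).Reachable (tail e) (head e) := by
  by_cases h : tail e = head e
  · rw [h]
  · exact (treeGraph_adj.2 ⟨h, e, he, Or.inl ⟨rfl, rfl⟩⟩).reachable

/-- Adding one edge only merges the components of its endpoints. -/
theorem treeGraph_reachable_insert {E : Finset (Fin r)} {a : Fin r} {x y : V}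
    (h : (treeGraph tail head (insert a E)).Reachable x y) :
    (treeGraph tail head E).Reachable x y ∨
      ((treeGraph tail head E).Reachable (tail a) x ∧
        (treeGraph tail head E).Reachable (head a) y) ∨
      ((treeGraph tail head E).Reachable (tail a) y ∧
        (treeGraph tail head E).Reachable (head a) x) := by
  rw [SimpleGraph.reachable_iff_reflTransGen] at h
  induction h with
  | refl => exact Or.inl (SimpleGraph.Reachable.refl _)
  | @tail y z _ hadj ih =>
    obtain ⟨hne, e, he, hyz⟩ := treeGraph_adj.1 hadj
    rcases Finset.mem_insert.1 he with rfl | he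
    · rcases hyz with ⟨rfl, rfl⟩ | ⟨rfl, rfl⟩
      · rcases ih with h | ⟨h₁, h₂⟩ | ⟨h₁, h₂⟩
        · exact Or.inr (Or.inl ⟨h.symm, SimpleGraph.Reachable.refl _⟩)
        · exact Or.inr (Or.inl ⟨h₁, SimpleGraph.Reachable.refl _⟩)
        · exact Or.inl h₂.symm
      · rcases ih with h | ⟨h₁, h₂⟩ | ⟨h₁, h₂⟩
        · exact Or.inr (Or.inr ⟨SimpleGraph.Reachable.refl _, h.symm⟩)
        · exact Or.inl h₁.symm
        · exact Or.inr (Or.inr ⟨SimpleGraph.Reachable.refl _, h₂⟩)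
    · have hyz' : (treeGraph tail head E).Reachable y z :=
        (treeGraph_adj.2 ⟨hne, e, he, hyz⟩).reachable
      rcases ih with h | ⟨h₁, h₂⟩ | ⟨h₁, h₂⟩
      · exact Or.inl (h.trans hyz')
      · exact Or.inr (Or.inl ⟨h₁, h₂.trans hyz'⟩)
      · exact Or.inr (Or.inr ⟨h₁.trans hyz', h₂⟩)

theorem treeGraph_card_edgeSet_le (E : Finset (Fin r)) :
    Nat.card (treeGraph tail head E).edgeSet ≤ E.card := by
  classical
  have hsub : (treeGraph tail head E).edgeSet ⊆
      (E.image fun e => s(tail e, head e) : Finset (Sym2 V)) := by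
    intro p
    induction p with
    | _ x y =>
      intro h
      obtain ⟨-, e, he, h⟩ := treeGraph_adj.1 ((SimpleGraph.mem_edgeSet _).1 h)
      rw [Finset.mem_coe, Finset.mem_image]
      refine ⟨e, he, ?_⟩
      rcases h with ⟨rfl, rfl⟩ | ⟨rfl, rfl⟩
      · rfl
      · exact Sym2.eq_swap
  calc Nat.card (treeGraph tail head E).edgeSet
      ≤ (E.image fun e => s(tail e, head e)).card := by
        rw [← Set.ncard_coe_finset]
        exact Set.ncard_le_ncard hsub (Finset.finite_toSet _)
    _ ≤ E.card := Finset.card_image_le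

/-- In a connected graph on `r + 1` vertices with `r` edges, no edge joins two vertices that
are already connected by the other edges. -/
theorem not_treeGraph_erase_reachable [Fintype V] (hV : Fintype.card V = r + 1)
    (hconn : (treeGraph tail head Finset.univ).Connected) (a : Fin r) :
    ¬ (treeGraph tail head (Finset.univ.erase a)).Reachable (tail a) (head a) := by
  intro h
  have hconn' : (treeGraph tail head (Finset.univ.erase a)).Connected := by
    have := hconn.nonempty
    refine ⟨fun x y => ?_⟩
    have hxy := hconn.preconnected x y
    rw [← Finset.insert_erase (Finset.mem_univ a)] at hxy
    rcases treeGraph_reachable_insert hxy with h' | ⟨h₁, h₂⟩ | ⟨h₁, h₂⟩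
    · exact h'
    · exact h₁.symm.trans (h.trans h₂)
    · exact h₂.symm.trans (h.symm.trans h₁)
  have h₁ := hconn'.card_vert_le_card_edgeSet_add_one
  have h₂ := treeGraph_card_edgeSet_le (tail := tail) (head := head) (Finset.univ.erase a)
  rw [Finset.card_erase_of_mem (Finset.mem_univ a), Finset.card_univ, Fintype.card_fin] at h₂
  rw [Nat.card_eq_fintype_card, hV] at h₁
  have := a.pos
  omega

/-- The vertex `x` precedes `y` if some edge `a` separates them, with `x` on the side of its
tail, once the edges `a, a + 1, …` are deleted. -/
def EdgePrecedes (tail head : Fin r → V) (x y : V) : Prop :=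
  ∃ a : Fin r,
    (treeGraph tail head (Finset.univ.filter (fun e => e < a))).Reachable (tail a) x ∧
    (treeGraph tail head (Finset.univ.filter (fun e => e < a))).Reachable (head a) y

theorem edgePrecedes_or_of_reachable {x y : V} (hne : x ≠ y)
    (h : (treeGraph tail head Finset.univ).Reachable x y) :
    EdgePrecedes tail head x y ∨ EdgePrecedes tail head y x := by
  have key : ∀ n : ℕ,
      (treeGraph tail head (Finset.univ.filter (fun e => e.val < n))).Reachable x y →
        EdgePrecedes tail head x y ∨ EdgePrecedes tail head y x := by
    intro n
    induction n with
    | zero =>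
      intro h
      have hbot : treeGraph tail head (Finset.univ.filter (fun e => e.val < 0)) = ⊥ := by
        ext u v
        simp [treeGraph_adj]
      rw [hbot, SimpleGraph.reachable_bot] at h
      exact absurd h hne
    | succ n ih =>
      intro h
      by_cases hn : n < r
      · have hE : (Finset.univ.filter (fun e : Fin r => e.val < n + 1)) =
            insert ⟨n, hn⟩ (Finset.univ.filter (fun e : Fin r => e.val < n)) := by
          ext e
          simp only [Finset.mem_filter, Finset.mem_univ, true_and, Finset.mem_insert, Fin.ext_iff]
          omega
        rw [hE] at h
        rcases treeGraph_reachable_insert h with h | h | h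
        · exact ih h
        · exact Or.inl ⟨⟨n, hn⟩, h⟩
        · exact Or.inr ⟨⟨n, hn⟩, h⟩
      · refine ih (h.mono (treeGraph_mono fun e _ => ?_))
        simp only [Finset.mem_filter, Finset.mem_univ, true_and]
        omega
  refine key r (h.mono (treeGraph_mono fun e _ => ?_))
  simp

theorem EdgePrecedes.irrefl [Fintype V] (hV : Fintype.card V = r + 1)
    (hconn : (treeGraph tail head Finset.univ).Connected) (x : V) :
    ¬ EdgePrecedes tail head x x := by
  rintro ⟨a, h₁, h₂⟩
  refine not_treeGraph_erase_reachable hV hconn a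
    ((h₁.trans h₂.symm).mono (treeGraph_mono fun e he => ?_))
  simp only [Finset.mem_filter, Finset.mem_univ, true_and] at he
  simpa using he.ne

theorem EdgePrecedes.trans [Fintype V] (hV : Fintype.card V = r + 1)
    (hconn : (treeGraph tail head Finset.univ).Connected) {x y z : V}
    (hxy : EdgePrecedes tail head x y) (hyz : EdgePrecedes tail head y z) :
    EdgePrecedes tail head x z := by
  have extend : ∀ {a b : Fin r} {u v : V}, a < b →
      (treeGraph tail head (Finset.univ.filter (fun e => e < a))).Reachable (tail a) u →
      (treeGraph tail head (Finset.univ.filter (fun e => e < a))).Reachable (head a) v →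
      (treeGraph tail head (Finset.univ.filter (fun e => e < b))).Reachable u v := by
    intro a b u v hab hu hv
    have hle : treeGraph tail head (Finset.univ.filter (fun e => e < a)) ≤
        treeGraph tail head (Finset.univ.filter (fun e => e < b)) :=
      treeGraph_mono fun e he => by
        simp only [Finset.mem_filter, Finset.mem_univ, true_and] at he ⊢
        exact he.trans hab
    exact (hu.mono hle).symm.trans
      ((treeGraph_reachable_edge (by simpa using hab)).trans (hv.mono hle))
  obtain ⟨a, hx, hy⟩ := hxy
  obtain ⟨b, hy', hz⟩ := hyz
  rcases lt_trichotomy a b with hab | rfl | hab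
  · exact ⟨b, hy'.trans (extend hab hx hy).symm, hz⟩
  · exact absurd ⟨a, hy', hy⟩ (EdgePrecedes.irrefl hV hconn y)
  · exact ⟨a, hx, hy.trans (extend hab hy' hz)⟩

theorem exists_equiv_fin_of_edgePrecedes [Fintype V] (hV : Fintype.card V = r + 1)
    (hconn : (treeGraph tail head Finset.univ).Connected) :
    ∃ w : V ≃ Fin (r + 1), ∀ x y, EdgePrecedes tail head x y → w x < w y := by
  classical
  have : IsStrictTotalOrder V (EdgePrecedes tail head) :=
    { irrefl := EdgePrecedes.irrefl hV hconn
      trans := fun _ _ _ => EdgePrecedes.trans hV hconn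
      trichotomous := fun x y h₁ h₂ => by
        by_contra hne
        rcases edgePrecedes_or_of_reachable hne (hconn.preconnected x y) with h | h
        · exact h₁ h
        · exact h₂ h }
  let : LinearOrder V := linearOrderOfSTO (EdgePrecedes tail head)
  let w : Fin (r + 1) ≃o V := Fintype.orderIsoFinOfCardEq V hV
  exact ⟨w.symm.toEquiv, fun x y h => w.symm.strictMono h⟩

theorem equiv_fin_eq_of_edgePrecedes (hconn : (treeGraph tail head Finset.univ).Connected)
    {w w' : V ≃ Fin (r + 1)} (hw : ∀ x y, EdgePrecedes tail head x y → w x < w y)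
    (hw' : ∀ x y, EdgePrecedes tail head x y → w' x < w' y) : w = w' := by
  have hmono : StrictMono (w.symm.trans w') := by
    intro i j hij
    have hne : w.symm i ≠ w.symm j := fun h => hij.ne (w.symm.injective h)
    rcases edgePrecedes_or_of_reachable hne (hconn.preconnected _ _) with h | h
    · exact hw' _ _ h
    · have := hw _ _ h
      simp only [Equiv.apply_symm_apply] at this
      exact absurd this hij.asymm
  let g : Fin (r + 1) ≃o Fin (r + 1) := hmono.orderIsoOfSurjective _ (Equiv.surjective _)
  have hg : g = OrderIso.refl _ := Subsingleton.elim _ _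
  ext x
  have h : g (w x) = w x := by rw [hg]; rfl
  have h' : g (w x) = w' x := by
    change w' (w.symm (w x)) = w' x
    rw [Equiv.symm_apply_apply]
  rw [← h', h]

/-- Relabeling the vertices is an isomorphism of tree graphs. -/
def treeGraphIso {W : Type*} (w : V ≃ W) (tail head : Fin r → V) (E : Finset (Fin r)) :
    treeGraph tail head E ≃g treeGraph (fun e => w (tail e)) (fun e => w (head e)) E where
  toEquiv := w
  map_rel_iff' := by
    intro x y
    simp [treeGraph_adj]

theorem treeGraph_reachable_relabel {W : Type*} (w : V ≃ W) {E : Finset (Fin r)} {x y : V} :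
    (treeGraph (fun e => w (tail e)) (fun e => w (head e)) E).Reachable (w x) (w y) ↔
      (treeGraph tail head E).Reachable x y :=
  (treeGraphIso w tail head E).reachable_iff

end TreeGraph

section Trees

variable {kk ll : Finset ℕ} {β r : ℕ}

theorem MarkedTree.ext_kv_sv {S S' : MarkedTree kk r} (hk : ∀ i, S.kv i = S'.kv i)
    (hs : ∀ i, S.sv i = S'.sv i) : S = S' := by
  have hh : S.head = S'.head := by
    funext e
    exact ((S'.mem_head e _).1 (hk _ ▸ (S.mem_head e _).2 rfl)).symm
  have ht : S.tail = S'.tail := by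
    funext e
    exact ((S'.mem_tail e _).1 (hs _ ▸ (S.mem_tail e _).2 rfl)).symm
  replace hk := funext hk
  replace hs := funext hs
  cases S
  cases S'
  simp only at hk hs hh ht
  subst hk hs hh ht
  rfl

theorem LabeledTree.ext_of_toMarked {T T' : LabeledTree kk ll β r}
    (hm : T.toMarked = T'.toMarked) (hl : ∀ i, T.lv i = T'.lv i) (hb : ∀ i, T.bv i = T'.bv i) :
    T = T' := by
  replace hl := funext hl
  replace hb := funext hb
  cases T
  cases T'
  simp only [LabeledTree.toMarked, MarkedTree.mk.injEq] at hm hl hb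
  obtain ⟨hk, hs, hh, ht⟩ := hm
  subst hk hs hh ht hl hb
  rfl

theorem IsVertexRelabel.head_eq {w : Equiv.Perm (Fin (r + 1))} {S S' : MarkedTree kk r}
    (h : IsVertexRelabel kk r w S S') (e : Fin r) : S'.head e = w (S.head e) := by
  rw [← S'.mem_head, h.1, ← Equiv.Perm.mul_apply, inv_mul_cancel]
  exact (S.mem_head e _).2 rfl

theorem IsVertexRelabel.tail_eq {w : Equiv.Perm (Fin (r + 1))} {S S' : MarkedTree kk r}
    (h : IsVertexRelabel kk r w S S') (e : Fin r) : S'.tail e = w (S.tail e) := by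
  rw [← S'.mem_tail, h.2, ← Equiv.Perm.mul_apply, inv_mul_cancel]
  exact (S.mem_tail e _).2 rfl

theorem IsVertexRelabel.lt_of_edgePrecedes {w : Equiv.Perm (Fin (r + 1))}
    {S : MarkedTree kk r} {T : LabeledTree kk ll β r}
    (h : IsVertexRelabel kk r w S T.toMarked) (x y : Fin (r + 1))
    (hxy : EdgePrecedes S.tail S.head x y) : w x < w y := by
  obtain ⟨a, hx, hy⟩ := hxy
  have hh : T.head = fun e => w (S.head e) := funext h.head_eq
  have ht : T.tail = fun e => w (S.tail e) := funext h.tail_eq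
  have hc := T.cond_c a (w x) (w y)
  rw [hh, ht] at hc
  exact hc ((treeGraph_reachable_relabel w).2 hx) ((treeGraph_reachable_relabel w).2 hy)

theorem IsInducedBy.unique {T T' T'' : LabeledTree kk ll β r} {S : MarkedTree kk r}
    (h' : IsInducedBy T' S T) (h'' : IsInducedBy T'' S T) : T' = T'' := by
  obtain ⟨w', hk', hs', hl', hb'⟩ := h'
  obtain ⟨w'', hk'', hs'', hl'', hb''⟩ := h''
  have hR' : IsVertexRelabel kk r w' S T'.toMarked := ⟨hk', hs'⟩
  have hR'' : IsVertexRelabel kk r w'' S T''.toMarked := ⟨hk'', hs''⟩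
  have hw : w' = w'' := equiv_fin_eq_of_edgePrecedes S.connected
    hR'.lt_of_edgePrecedes hR''.lt_of_edgePrecedes
  subst hw
  exact LabeledTree.ext_of_toMarked
    (MarkedTree.ext_kv_sv (fun i => (hk' i).trans (hk'' i).symm)
      fun i => (hs' i).trans (hs'' i).symm)
    (fun i => (hl' i).trans (hl'' i).symm) fun i => (hb' i).trans (hb'' i).symm

theorem biUnion_comp_perm {ι γ : Type*} [Fintype ι] [DecidableEq γ] (f : ι → Finset γ)
    (w : Equiv.Perm ι) : Finset.univ.biUnion (fun i => f (w i)) = Finset.univ.biUnion f := by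
  ext x
  simp only [Finset.mem_biUnion, Finset.mem_univ, true_and]
  exact w.exists_congr_left.trans (by simp)

/-- The labeled tree with the boundary data of `S` and the interior data of `T`, whose
vertices are relabeled by a permutation compatible with the edge order. -/
def MarkedTree.relabel (S : MarkedTree kk r) (T : LabeledTree kk ll β r)
    (hcard : ∀ i, (S.kv i).card = (T.kv i).card) (w : Equiv.Perm (Fin (r + 1)))
    (hw : ∀ x y, EdgePrecedes S.tail S.head x y → w x < w y) : LabeledTree kk ll β r where
  kv i := S.kv (w⁻¹ i)
  lv i := T.lv (w⁻¹ i)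
  bv i := T.bv (w⁻¹ i)
  sv i := S.sv (w⁻¹ i)
  head e := w (S.head e)
  tail e := w (S.tail e)
  mem_head e i := by rw [S.mem_head, Equiv.Perm.eq_inv_iff_eq]
  mem_tail e i := by rw [S.mem_tail, Equiv.Perm.eq_inv_iff_eq]
  sturdy i := by rw [hcard]; exact T.sturdy _
  orient i := by rw [hcard]; exact T.orient _
  kv_disjoint i j hij := S.kv_disjoint _ _ fun h => hij (w⁻¹.injective h)
  kv_union := (biUnion_comp_perm S.kv w⁻¹).trans S.kv_union
  lv_disjoint i j hij := T.lv_disjoint _ _ fun h => hij (w⁻¹.injective h)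
  lv_union := (biUnion_comp_perm T.lv w⁻¹).trans T.lv_union
  sv_disjoint i j hij := S.sv_disjoint _ _ fun h => hij (w⁻¹.injective h)
  sv_union := (biUnion_comp_perm S.sv w⁻¹).trans S.sv_union
  bv_sum := (Equiv.sum_comp w⁻¹ T.bv).trans T.bv_sum
  connected := (treeGraphIso w S.tail S.head Finset.univ).connected_iff.1 S.connected
  cond_c a x y hx hy := by
    obtain ⟨x, rfl⟩ := w.surjective x
    obtain ⟨y, rfl⟩ := w.surjective y
    exact hw x y ⟨a, (treeGraph_reachable_relabel w).1 hx, (treeGraph_reachable_relabel w).1 hy⟩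

theorem exists_isInducedBy (S : MarkedTree kk r) (T : LabeledTree kk ll β r)
    (hcard : ∀ i, (S.kv i).card = (T.kv i).card) : ∃ T', IsInducedBy T' S T := by
  obtain ⟨w, hw⟩ := exists_equiv_fin_of_edgePrecedes (Fintype.card_fin (r + 1)) S.connected
  exact ⟨S.relabel T hcard w hw, w, fun _ => rfl, fun _ => rfl, fun _ => rfl, fun _ => rfl⟩

theorem MarkedTree.mem_of_mem_kv (S : MarkedTree kk r) {i : Fin (r + 1)} {x : ℕ ⊕ Fin r}
    (hx : x ∈ S.kv i) :
    x ∈ kk.image Sum.inl ∪ (Finset.univ : Finset (Fin r)).image Sum.inr := by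
  rw [← S.kv_union]
  exact Finset.mem_biUnion.2 ⟨i, Finset.mem_univ i, hx⟩

theorem IsWitness.card_kv {ρ : Equiv.Perm (MarkedTree kk r × BMark kk r)}
    {α : Equiv.Perm (MarkedTree kk r)} {F : MarkedTree kk r → Equiv.Perm (BMark kk r)}
    (h : IsWitness kk r ρ α F) (S : MarkedTree kk r) (i : Fin (r + 1)) :
    ((α S).kv i).card = (S.kv i).card := by
  symm
  refine Finset.card_bij (fun x hx => (F S ⟨x, S.mem_of_mem_kv hx⟩).val) ?_ ?_ ?_
  · intro x hx
    exact (h.2 S i ⟨x, S.mem_of_mem_kv hx⟩).1 hx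
  · intro x hx y hy hxy
    exact congrArg Subtype.val ((F S).injective (Subtype.ext hxy))
  · intro y hy
    obtain ⟨x, hx⟩ := (F S).surjective ⟨y, (α S).mem_of_mem_kv hy⟩
    have hy' : (F S x).val = y := congrArg Subtype.val hx
    exact ⟨x.val, (h.2 S i x).2 (hy'.symm ▸ hy), hy'⟩

/-- Without boundary markings there are no edges, hence only one marked tree. -/
theorem MarkedTree.subsingleton_of_isEmpty [IsEmpty (BMark kk r)] :
    Subsingleton (MarkedTree kk r) := by
  have hr : IsEmpty (Fin r) := ⟨fun e => isEmptyElim (α := BMark kk r) ⟨Sum.inr e, by simp⟩⟩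
  have hk : ∀ (S : MarkedTree kk r) i, S.kv i = ∅ := fun S i =>
    Finset.eq_empty_of_forall_notMem fun x hx =>
      isEmptyElim (α := BMark kk r) ⟨x, S.mem_of_mem_kv hx⟩
  exact ⟨fun S S' => MarkedTree.ext_kv_sv (fun i => (hk S i).trans (hk S' i).symm)
    fun i => Subsingleton.elim _ _⟩

theorem IsWitness.unique {ρ : Equiv.Perm (MarkedTree kk r × BMark kk r)}
    {α α' : Equiv.Perm (MarkedTree kk r)} {F F' : MarkedTree kk r → Equiv.Perm (BMark kk r)}
    (h : IsWitness kk r ρ α F) (h' : IsWitness kk r ρ α' F') : α = α' := by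
  ext1 S
  rcases isEmpty_or_nonempty (BMark kk r) with hE | ⟨⟨x⟩⟩
  · have := MarkedTree.subsingleton_of_isEmpty (kk := kk) (r := r)
    exact Subsingleton.elim _ _
  · exact congrArg Prod.fst ((h.1 S x).symm.trans (h'.1 S x))

theorem IsWitness.one : IsWitness kk r 1 1 fun _ => 1 :=
  ⟨fun _ _ => rfl, fun _ _ _ => Iff.rfl⟩

theorem IsWitness.mul {ρ₁ ρ₂ : Equiv.Perm (MarkedTree kk r × BMark kk r)}
    {α₁ α₂ : Equiv.Perm (MarkedTree kk r)} {F₁ F₂ : MarkedTree kk r → Equiv.Perm (BMark kk r)}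
    (h₁ : IsWitness kk r ρ₁ α₁ F₁) (h₂ : IsWitness kk r ρ₂ α₂ F₂) :
    IsWitness kk r (ρ₁ * ρ₂) (α₁ * α₂) fun S => F₁ (α₂ S) * F₂ S := by
  refine ⟨fun S x => ?_, fun S i x => ?_⟩
  · rw [Equiv.Perm.mul_apply, h₂.1, h₁.1]
    rfl
  · rw [h₂.2, h₁.2]
    rfl

theorem MemR.isVertexRelabel {ρ : Equiv.Perm (MarkedTree kk r × BMark kk r)}
    (hρ : MemR kk r ρ) {α : Equiv.Perm (MarkedTree kk r)}
    {F : MarkedTree kk r → Equiv.Perm (BMark kk r)} (h : IsWitness kk r ρ α F)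
    {w : Equiv.Perm (Fin (r + 1))} {S S' : MarkedTree kk r}
    (hS : IsVertexRelabel kk r w S S') : IsVertexRelabel kk r w (α S) (α S') := by
  rcases isEmpty_or_nonempty (BMark kk r) with hE | ⟨⟨x⟩⟩
  · have := MarkedTree.subsingleton_of_isEmpty (kk := kk) (r := r)
    rwa [Subsingleton.elim (α S) S, Subsingleton.elim (α S') S']
  · have := (hρ.2 w S S' x hS).1
    rwa [h.1, h.1] at this

theorem IsInducedBy.comp {ρ : Equiv.Perm (MarkedTree kk r × BMark kk r)}
    (hρ : MemR kk r ρ) {α : Equiv.Perm (MarkedTree kk r)}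
    {F : MarkedTree kk r → Equiv.Perm (BMark kk r)} (h : IsWitness kk r ρ α F)
    {S : MarkedTree kk r} {T T' T'' : LabeledTree kk ll β r}
    (h' : IsInducedBy T' S T) (h'' : IsInducedBy T'' (α T'.toMarked) T') :
    IsInducedBy T'' (α S) T := by
  obtain ⟨w', hk', hs', hl', hb'⟩ := h'
  obtain ⟨w'', hk'', hs'', hl'', hb''⟩ := h''
  obtain ⟨hk, hs⟩ := hρ.isVertexRelabel h (S := S) (S' := T'.toMarked) ⟨hk', hs'⟩
  refine ⟨w'' * w', fun i => ?_, fun i => ?_, fun i => ?_, fun i => ?_⟩ <;>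
    rw [mul_inv_rev, Equiv.Perm.mul_apply]
  · rw [hk'', hk]
  · rw [hs'', hs]
  · rw [hl'', hl']
  · rw [hb'', hb']

end Trees

theorem Rkr_acts_on_labeled_trees
    (kk ll : Finset ℕ) (β r : ℕ)
    (hstable : 3 ≤ kk.card + 2 * ll.card + 3 * β)
    (horient : Odd (kk.card + β)) :
    ∃ act : Equiv.Perm (MarkedTree kk r × BMark kk r) →
        LabeledTree kk ll β r → LabeledTree kk ll β r,
      -- `ρ.𝒯` is again a `(𝔟, r)`-labeled tree, obtained from `α^ρ(𝒯̲)` and the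
      -- interior data of `𝒯` by the unique vertex relabeling restoring condition (c):
      (∀ ρ, MemR kk r ρ → ∀ α F, IsWitness kk r ρ α F →
          ∀ T : LabeledTree kk ll β r, IsInducedBy (act ρ T) (α T.toMarked) T) ∧
      -- this assignment is a group action of `R_𝗄^r`:
      (∀ ρ₁ ρ₂, MemR kk r ρ₁ → MemR kk r ρ₂ →
          ∀ T, act (ρ₁ * ρ₂) T = act ρ₁ (act ρ₂ T)) ∧
      (∀ T, act 1 T = T) := by
  have hex : ∀ (ρ : Equiv.Perm (MarkedTree kk r × BMark kk r)) (T : LabeledTree kk ll β r),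
      ∃ T' : LabeledTree kk ll β r,
        ∀ α F, IsWitness kk r ρ α F → IsInducedBy T' (α T.toMarked) T := by
    intro ρ T
    by_cases hρ : MemRhat kk r ρ
    · obtain ⟨α, F, h⟩ := hρ
      obtain ⟨T', hT'⟩ := exists_isInducedBy (α T.toMarked) T (h.card_kv T.toMarked)
      exact ⟨T', fun α' F' h' => h.unique h' ▸ hT'⟩
    · exact ⟨T, fun α F h => absurd ⟨α, F, h⟩ hρ⟩
  choose act hact using hex
  refine ⟨act, fun ρ _ α F h T => hact ρ T α F h, ?_, ?_⟩
  · intro ρ₁ ρ₂ h₁ h₂ T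
    obtain ⟨α₁, F₁, hw₁⟩ := h₁.1
    obtain ⟨α₂, F₂, hw₂⟩ := h₂.1
    exact (hact (ρ₁ * ρ₂) T _ _ (hw₁.mul hw₂)).unique
      (IsInducedBy.comp h₁ hw₁ (hact ρ₂ T _ _ hw₂) (hact ρ₁ (act ρ₂ T) _ _ hw₁))
  · intro T
    exact (hact 1 T _ _ IsWitness.one).unique
      ⟨1, fun _ => rfl, fun _ => rfl, fun _ => rfl, fun _ => rfl⟩
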